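/- Gluing formula for transposition factorizations: for every positive integer d, all partitions μ⁺, μ⁻ of d, and all integers r₁, r₂ ≥ 0, one has N_{r₁+r₂}(μ⁺, μ⁻) / d! = Σ_{ν a partition of d} (N_{r₁}(μ⁺, ν) / d!) · z_ν · (N_{r₂}(ν, μ⁻) / d!), where for partitions α, β of d and r ≥ 0, N_r(α, β) denotes the number of tuples (σ, τ_1, …, τ_r) ∈ (S_d)^{r+1} such that σ has cycle type α, each τ_i is a transposition, and σ·τ_1·⋯·τ_r has cycle type β. -/

import Mathlib

open scoped BigOperators Classical

noncomputable section

namespace DoubleHurwitz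

/-- The cycle type of a permutation of `{1, …, d}`, counting fixed points as cycles of
length 1 (Mathlib's `Equiv.Perm.cycleType` records only the nontrivial cycles). -/
def fullCycleType {d : ℕ} (σ : Equiv.Perm (Fin d)) : Multiset ℕ :=
  σ.cycleType + Multiset.replicate (d - σ.cycleType.sum) 1

/-- `σ` has cycle type `μ`, where fixed points count as cycles of length 1. -/
def HasCycleType {d : ℕ} (σ : Equiv.Perm (Fin d)) (μ : Nat.Partition d) : Prop :=
  fullCycleType σ = μ.parts

/-- `z_μ = ∏_{j ≥ 1} m_j(μ)! · j^{m_j(μ)}` where `m_j(μ)` is the number of parts equal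
to `j` (all parts lie in `{1, …, d}`). -/
def zPart {d : ℕ} (μ : Nat.Partition d) : ℕ :=
  ∏ j ∈ Finset.Icc 1 d, Nat.factorial (μ.parts.count j) * j ^ (μ.parts.count j)

/-- `χ : S_d → ℂ` is an irreducible (complex) character: the character of some simple
finite-dimensional complex representation of `S_d`. -/
def IsIrredChar (d : ℕ) (χ : Equiv.Perm (Fin d) → ℂ) : Prop :=
  ∃ V : FDRep ℂ (Equiv.Perm (Fin d)), CategoryTheory.Simple V ∧ χ = V.character

/-- The (finite) type of irreducible complex characters of `S_d`. -/
def IrredChar (d : ℕ) : Type :=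
  {χ : Equiv.Perm (Fin d) → ℂ // IsIrredChar d χ}

/-- `f_χ = (d(d−1)/2)·χ(t)/χ(1)` for any transposition `t`.  Since characters are class
functions and the `d(d−1)/2` transpositions form a single conjugacy class, this value
equals the sum of `χ(t)/χ(1)` over all transpositions `t`, which is how we encode it
(this avoids an arbitrary choice of transposition, and gives `0` when `d = 1`,
matching `d(d−1)/2 = 0`). -/
def fChar {d : ℕ} (χ : Equiv.Perm (Fin d) → ℂ) : ℂ :=
  ∑ t ∈ Finset.univ.filter (fun t : Equiv.Perm (Fin d) => t.IsSwap), χ t / χ 1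

/-- The disconnected double Hurwitz generating function
`Φ•_{μ,ν}(λ) = Σ_χ (χ(σ_μ)/z_μ)·(χ(σ_ν)/z_ν)·e^{f_χ λ}`, the sum ranging over the
irreducible complex characters of `S_d`, where `rep` is a choice of a permutation
`σ_μ = rep μ` of each cycle type `μ`. -/
def Phi {d : ℕ} (rep : Nat.Partition d → Equiv.Perm (Fin d)) (μ ν : Nat.Partition d)
    (lam : ℂ) : ℂ :=
  ∑ᶠ χ : IrredChar d,
    (χ.1 (rep μ) / zPart μ) * (χ.1 (rep ν) / zPart ν) * Complex.exp (fChar χ.1 * lam)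

end DoubleHurwitz
namespace DoubleHurwitz

/-- The number of tuples `(σ, τ_1, …, τ_r)` of permutations of `{1, …, d}` such that
`σ` has cycle type `μp`, each `τ_i` is a transposition, and the ordered product
`σ·τ_1·⋯·τ_r` has cycle type `μm`. -/
def Ntuples (d r : ℕ) (μp μm : Nat.Partition d) : ℕ :=
  (Finset.univ.filter
    (fun p : Equiv.Perm (Fin d) × (Fin r → Equiv.Perm (Fin d)) =>
      HasCycleType p.1 μp ∧ (∀ i : Fin r, (p.2 i).IsSwap) ∧
        HasCycleType (p.1 * (List.ofFn p.2).prod) μm)).card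

end DoubleHurwitz

namespace DoubleHurwitz

/-- The partition of `d` formed by all cycle lengths of `σ`. -/
def fullPartition {d : ℕ} (σ : Equiv.Perm (Fin d)) : Nat.Partition d where
  parts := fullCycleType σ
  parts_pos {n hn} := by
    rcases Multiset.mem_add.mp hn with hn | hn
    · exact zero_lt_one.trans (Equiv.Perm.one_lt_of_mem_cycleType hn)
    · exact (Multiset.eq_of_mem_replicate hn).symm ▸ zero_lt_one
  parts_sum := by
    have h : σ.cycleType.sum ≤ d := by
      simpa [Equiv.Perm.sum_cycleType] using σ.support.card_le_univ
    simp [fullCycleType, h]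

theorem hasCycleType_iff {d : ℕ} {σ : Equiv.Perm (Fin d)} {ν : Nat.Partition d} :
    HasCycleType σ ν ↔ fullPartition σ = ν := by
  rw [Nat.Partition.ext_iff]
  rfl

theorem fullCycleType_eq_iff {d : ℕ} {σ τ : Equiv.Perm (Fin d)} :
    fullCycleType σ = fullCycleType τ ↔ σ.cycleType = τ.cycleType := by
  refine ⟨fun h => ?_, fun h => by rw [fullCycleType, fullCycleType, h]⟩
  have key : ∀ ρ : Equiv.Perm (Fin d),
      (fullCycleType ρ).filter (fun n => 2 ≤ n) = ρ.cycleType := fun ρ => by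
    rw [fullCycleType, Multiset.filter_add, Multiset.filter_eq_self.2 fun _ =>
      Equiv.Perm.two_le_of_mem_cycleType, Multiset.filter_eq_nil.2 fun a h => ?_, add_zero]
    rw [Multiset.eq_of_mem_replicate h]
    decide
  rw [← key σ, ← key τ, h]

theorem zPart_eq {d : ℕ} {σ : Equiv.Perm (Fin d)} {ν : Nat.Partition d} (hd : 0 < d)
    (h : HasCycleType σ ν) :
    zPart ν = (d - σ.cycleType.sum).factorial * σ.cycleType.prod *
      ∏ n ∈ σ.cycleType.toFinset, (σ.cycleType.count n).factorial := by
  have h1 : σ.cycleType.count 1 = 0 :=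
    Multiset.count_eq_zero.2 fun hm => absurd (Equiv.Perm.two_le_of_mem_cycleType hm) (by decide)
  have hsub : σ.cycleType.toFinset ⊆ Finset.Ioc 1 d := fun n hn => by
    rw [Multiset.mem_toFinset] at hn
    refine Finset.mem_Ioc.2 ⟨Equiv.Perm.one_lt_of_mem_cycleType hn, ?_⟩
    refine (Multiset.le_sum_of_mem hn).trans ?_
    simpa [Equiv.Perm.sum_cycleType] using σ.support.card_le_univ
  have hcount : ∀ n ∈ Finset.Ioc 1 d, ν.parts.count n = σ.cycleType.count n := fun n hn => by
    rw [← h, fullCycleType, Multiset.count_add, Multiset.count_replicate,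
      if_neg (Finset.mem_Ioc.1 hn).1.ne, add_zero]
  have hone : ν.parts.count 1 = d - σ.cycleType.sum := by
    rw [← h, fullCycleType, Multiset.count_add, h1, Multiset.count_replicate_self, zero_add]
  rw [zPart, Finset.Icc_eq_cons_Ioc hd, Finset.prod_cons, hone, one_pow, mul_one,
    Finset.prod_congr rfl fun n hn => by rw [hcount n hn],
    ← Finset.prod_subset hsub fun n _ hn => by
      rw [Multiset.count_eq_zero.2 (by simpa using hn)]; simp,
    Finset.prod_mul_distrib, Finset.prod_multiset_count σ.cycleType]
  ring

theorem card_hasCycleType_mul_zPart {d : ℕ} (hd : 0 < d) {σ : Equiv.Perm (Fin d)}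
    {ν : Nat.Partition d} (h : HasCycleType σ ν) :
    (Finset.univ.filter fun ρ : Equiv.Perm (Fin d) => HasCycleType ρ ν).card * zPart ν =
      d.factorial := by
  have hc := Equiv.Perm.card_isConj_mul_eq σ
  rw [Fintype.card_fin, ← zPart_eq hd h, Nat.card_eq_fintype_card, Fintype.card_subtype] at hc
  rw [← hc]
  congr 2
  ext ρ
  rw [Finset.mem_filter_univ, Finset.mem_filter_univ]
  change _ ↔ IsConj σ ρ
  rw [Equiv.Perm.isConj_iff_cycleType_eq, ← fullCycleType_eq_iff, HasCycleType, ← h, eq_comm]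

/-- The number of `r`-tuples of transpositions whose product, multiplied on the left by `σ`,
has cycle type `β`. -/
def swapCount {d : ℕ} (r : ℕ) (β : Nat.Partition d) (σ : Equiv.Perm (Fin d)) : ℕ :=
  (Finset.univ.filter fun τ : Fin r → Equiv.Perm (Fin d) =>
    (∀ i, (τ i).IsSwap) ∧ HasCycleType (σ * (List.ofFn τ).prod) β).card

theorem hasCycleType_conj {d : ℕ} {σ g : Equiv.Perm (Fin d)} {β : Nat.Partition d} :
    HasCycleType (MulAut.conj g σ) β ↔ HasCycleType σ β := by
  rw [HasCycleType, HasCycleType, fullCycleType_eq_iff.2]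
  exact Equiv.Perm.cycleType_conj

theorem isSwap_conj {d : ℕ} {σ g : Equiv.Perm (Fin d)} :
    (MulAut.conj g σ).IsSwap ↔ σ.IsSwap := by
  rw [Equiv.Perm.isSwap_iff_cycleType, Equiv.Perm.isSwap_iff_cycleType, MulAut.conj_apply,
    Equiv.Perm.cycleType_conj]

theorem swapCount_conj {d : ℕ} (r : ℕ) (β : Nat.Partition d) (σ g : Equiv.Perm (Fin d)) :
    swapCount r β (MulAut.conj g σ) = swapCount r β σ := by
  symm
  refine Finset.card_equiv (Equiv.arrowCongr (Equiv.refl _) (MulAut.conj g).toEquiv) fun τ => ?_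
  rw [Finset.mem_filter_univ, Finset.mem_filter_univ]
  have hp : (List.ofFn ((Equiv.arrowCongr (Equiv.refl (Fin r)) (MulAut.conj g).toEquiv) τ)).prod =
      MulAut.conj g (List.ofFn τ).prod := by
    rw [map_list_prod, List.map_ofFn]
    rfl
  rw [hp, ← map_mul, hasCycleType_conj]
  exact and_congr_left fun _ => forall_congr' fun i => isSwap_conj.symm

theorem swapCount_eq {d : ℕ} (r : ℕ) (β : Nat.Partition d) {σ ρ : Equiv.Perm (Fin d)}
    (h : fullCycleType σ = fullCycleType ρ) : swapCount r β σ = swapCount r β ρ := by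
  obtain ⟨g, rfl⟩ := isConj_iff.1
    (Equiv.Perm.isConj_iff_cycleType_eq.2 (fullCycleType_eq_iff.1 h))
  exact (swapCount_conj r β σ g).symm

theorem Ntuples_eq_sum {d : ℕ} (r : ℕ) (α β : Nat.Partition d) :
    Ntuples d r α β =
      ∑ σ : Equiv.Perm (Fin d) with HasCycleType σ α, swapCount r β σ := by
  simp only [Ntuples, swapCount, Finset.card_filter, Fintype.sum_prod_type, Finset.sum_filter]
  refine Finset.sum_congr rfl fun σ _ => ?_
  split_ifs with h <;> simp [h]

theorem zPart_mul_Ntuples {d : ℕ} (hd : 0 < d) (r : ℕ) (β : Nat.Partition d)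
    {σ : Equiv.Perm (Fin d)} {ν : Nat.Partition d} (h : HasCycleType σ ν) :
    zPart ν * Ntuples d r ν β = d.factorial * swapCount r β σ := by
  rw [Ntuples_eq_sum, Finset.sum_const_nat (m := swapCount r β σ) fun ρ hρ =>
      swapCount_eq r β (((Finset.mem_filter_univ _).1 hρ).trans h.symm),
    ← card_hasCycleType_mul_zPart hd h]
  ring

theorem swapCount_add {d : ℕ} (r s : ℕ) (β : Nat.Partition d) (σ : Equiv.Perm (Fin d)) :
    swapCount (r + s) β σ =
      ∑ τ : Fin r → Equiv.Perm (Fin d) with ∀ i, (τ i).IsSwap,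
        swapCount s β (σ * (List.ofFn τ).prod) := by
  simp only [swapCount, Finset.card_filter, Finset.sum_filter]
  rw [← (Fin.appendEquiv r s).sum_comp, Fintype.sum_prod_type]
  refine Finset.sum_congr rfl fun τ _ => ?_
  have hs : ∀ τ' : Fin s → Equiv.Perm (Fin d),
      (∀ i, (Fin.append τ τ' i).IsSwap) ↔ (∀ i, (τ i).IsSwap) ∧ ∀ i, (τ' i).IsSwap :=
    fun τ' => by simp [Fin.forall_fin_add]
  simp only [Fin.appendEquiv, Equiv.coe_fn_mk, hs, List.ofFn_fin_append, List.prod_append,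
    mul_assoc]
  split_ifs with h <;> simp [h]

theorem sum_swapCount_mul {d : ℕ} (r : ℕ) (σ : Equiv.Perm (Fin d)) (f : Nat.Partition d → ℕ) :
    ∑ ν, swapCount r ν σ * f ν =
      ∑ τ : Fin r → Equiv.Perm (Fin d) with ∀ i, (τ i).IsSwap,
        f (fullPartition (σ * (List.ofFn τ).prod)) := by
  simp only [swapCount, Finset.card_filter, Finset.sum_filter, Finset.sum_mul]
  rw [Finset.sum_comm]
  refine Finset.sum_congr rfl fun τ _ => ?_
  split_ifs with h <;> simp [h, hasCycleType_iff]

theorem factorial_mul_Ntuples_add {d : ℕ} (hd : 0 < d) (r s : ℕ) (α β : Nat.Partition d) :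
    d.factorial * Ntuples d (r + s) α β =
      ∑ ν, Ntuples d r α ν * (zPart ν * Ntuples d s ν β) := by
  simp only [Ntuples_eq_sum r, Ntuples_eq_sum (r + s), Finset.sum_mul, Finset.mul_sum]
  rw [Finset.sum_comm]
  refine Finset.sum_congr rfl fun σ _ => ?_
  rw [sum_swapCount_mul, swapCount_add, Finset.mul_sum]
  exact Finset.sum_congr rfl fun τ _ => (zPart_mul_Ntuples hd s β (hasCycleType_iff.2 rfl)).symm

end DoubleHurwitz

open DoubleHurwitz in
/-- **Gluing formula for transposition factorizations.** -/
theorem gluing_formula (d : ℕ) (hd : 0 < d)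
    (μp μm : Nat.Partition d) (r1 r2 : ℕ) :
    (Ntuples d (r1 + r2) μp μm : ℚ) / (d.factorial : ℚ)
      = ∑ ν : Nat.Partition d,
          ((Ntuples d r1 μp ν : ℚ) / (d.factorial : ℚ)) * (zPart ν : ℚ) *
            ((Ntuples d r2 ν μm : ℚ) / (d.factorial : ℚ)) := by
  have hf : (d.factorial : ℚ) ≠ 0 := Nat.cast_ne_zero.2 d.factorial_ne_zero
  have key : (d.factorial : ℚ) * Ntuples d (r1 + r2) μp μm =
      ∑ ν, (Ntuples d r1 μp ν : ℚ) * (zPart ν * Ntuples d r2 ν μm) :=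
    mod_cast factorial_mul_Ntuples_add hd r1 r2 μp μm
  rw [div_eq_iff hf, Finset.sum_mul, ← mul_right_inj' hf, key, Finset.mul_sum]
  refine Finset.sum_congr rfl fun ν _ => ?_
  field_simp
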